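/- Let $F\subset\overline{B}(0,1)\subset\mathbb{R}^d$ be a Borel set and $0<s<d$. Then for every $p$ with $0<p\le 1$, there exists a Borel set $F_1\subset F$ with $\mathcal{L}(F_1) = p\,\mathcal{L}(F)$ and $I_s(F_1) \le 2p^2 I_s(F)$. -/

import Mathlib

open MeasureTheory Filter Set
open scoped ENNReal NNReal

/-- The `s`-energy of a measure: `∬ |x-y|^{-s} dμ dμ`. -/
noncomputable def energy {X : Type*} [EMetricSpace X] [MeasurableSpace X] (s : ℝ)
    (μ : Measure X) : ℝ≥0∞ :=
  ∫⁻ x, ∫⁻ y, edist x y ^ (-s) ∂μ ∂μ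

lemma exists_sub_vol {d : ℕ} (hd : 0 < d) (A : Set (EuclideanSpace ℝ (Fin d)))
    (hA : MeasurableSet A) (hsub : A ⊆ Metric.closedBall 0 1) (c : ℝ≥0∞) (hc : c ≤ volume A) :
    ∃ B, MeasurableSet B ∧ B ⊆ A ∧ volume B = c := by
  have : Nonempty (Fin d) := ⟨⟨0, hd⟩⟩
  have hfin : volume A ≠ ∞ :=
    ((measure_mono hsub).trans_lt measure_closedBall_lt_top).ne
  have hm : Measurable (fun x : EuclideanSpace ℝ (Fin d) => ‖x‖) := measurable_norm
  have : IsFiniteMeasure (volume.restrict A) := ⟨by simpa using hfin.lt_top⟩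
  set ν : Measure ℝ := (volume.restrict A).map (fun x => ‖x‖) with hν
  have hνf : IsFiniteMeasure ν := by rw [hν]; infer_instance
  have hna : NullSingletonClass ν := by
    refine ⟨fun r => ?_⟩
    rw [hν, Measure.map_apply hm (measurableSet_singleton r)]
    refine le_antisymm ((Measure.restrict_apply_le _ _).trans ?_) bot_le
    have : (fun x : EuclideanSpace ℝ (Fin d) => ‖x‖) ⁻¹' {r} = Metric.sphere 0 r := by
      ext x; simp
    rw [this, Measure.addHaar_sphere]
  have hcont : Continuous (fun r => ∫ _x in (0:ℝ)..r, (1:ℝ) ∂ν) :=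
    intervalIntegral.continuous_primitive (fun a b => by simp) 0
  have key : ∀ r, 0 ≤ r → ∫ _x in (0:ℝ)..r, (1:ℝ) ∂ν
      = (volume (A ∩ {x | ‖x‖ ∈ Ioc 0 r})).toReal := by
    intro r hr
    rw [intervalIntegral.integral_of_le hr]
    simp only [integral_const, smul_eq_mul, mul_one, Measure.real]
    rw [Measure.restrict_apply_univ, hν, Measure.map_apply hm measurableSet_Ioc,
      Measure.restrict_apply (hm measurableSet_Ioc), inter_comm]
    rfl
  have h1 : volume (A ∩ {x | ‖x‖ ∈ Ioc 0 1}) = volume A := by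
    refine le_antisymm (measure_mono inter_subset_left) ?_
    have : A ⊆ (A ∩ {x | ‖x‖ ∈ Ioc 0 1}) ∪ {0} := by
      intro x hx
      by_cases h0 : x = 0
      · right; exact h0
      · left; exact ⟨hx, by simpa using h0, by simpa using hsub hx⟩
    calc volume A ≤ _ := measure_mono this
      _ ≤ _ := measure_union_le _ _
      _ = _ := by simp
  have := intermediate_value_Icc (zero_le_one' ℝ) hcont.continuousOn
  have hmem : c.toReal ∈ Icc (∫ _x in (0:ℝ)..0, (1:ℝ) ∂ν) (∫ _x in (0:ℝ)..1, (1:ℝ) ∂ν) := by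
    rw [key 1 zero_le_one, h1]
    simp only [intervalIntegral.integral_same]
    exact ⟨ENNReal.toReal_nonneg, ENNReal.toReal_mono hfin hc⟩
  obtain ⟨r, hr, hr2⟩ := this hmem
  refine ⟨A ∩ {x | ‖x‖ ∈ Ioc 0 r}, hA.inter (hm measurableSet_Ioc), inter_subset_left, ?_⟩
  simp only at hr2
  rw [key r hr.1] at hr2
  exact (ENNReal.toReal_eq_toReal_iff' ((measure_mono inter_subset_left).trans_lt hfin.lt_top).ne
    (hc.trans_lt hfin.lt_top).ne).1 hr2

lemma exists_part {d : ℕ} (hd : 0 < d) (v : ℝ≥0∞) (hv : v ≠ ∞) (N : ℕ) :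
    ∀ (A : Set (EuclideanSpace ℝ (Fin d))), MeasurableSet A → A ⊆ Metric.closedBall 0 1 →
    N * v ≤ volume A →
    ∃ Q : ℕ → Set (EuclideanSpace ℝ (Fin d)), (∀ i, MeasurableSet (Q i)) ∧ (∀ i, Q i ⊆ A) ∧
      (∀ i < N, volume (Q i) = v) ∧ Pairwise (Function.onFun Disjoint Q) := by
  induction N with
  | zero =>
    intro A hA hs h
    refine ⟨fun _ => ∅, by simp, by simp, by simp, fun i j _ => by simp [Function.onFun]⟩
  | succ n ih =>
    intro A hA hs h
    push_cast at h
    rw [add_mul, one_mul] at h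
    obtain ⟨B, hB, hBA, hBv⟩ := exists_sub_vol hd A hA hs v (le_add_self.trans h)
    obtain ⟨Q, hQ1, hQ2, hQ3, hQ4⟩ := ih (A \ B) (hA.diff hB) (sdiff_subset.trans hs) (by
      rw [measure_sdiff hBA hB.nullMeasurableSet (by rwa [hBv]), hBv]
      exact ENNReal.le_sub_of_add_le_right hv h)
    refine ⟨fun i => if i < n then Q i else if i = n then B else ∅, ?_, ?_, ?_, ?_⟩
    · intro i; dsimp only; split_ifs <;> simp [hQ1, hB]
    · intro i; dsimp only; split_ifs <;> simp [hBA, (hQ2 i).trans sdiff_subset]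
    · intro i hi; dsimp only
      split_ifs with h1 h2
      · exact hQ3 i h1
      · exact hBv
      · omega
    · intro i j hij
      have hd : ∀ i, Disjoint (Q i) B := fun i => 
        disjoint_sdiff_left.mono_left (hQ2 i)
      simp only [Function.onFun]
      split_ifs <;> first | omega | exact hQ4 hij | exact hd _ | exact (hd _).symm | simp

lemma greedy (b : ℕ → ℕ → ℝ) (hb0 : ∀ i, b i i = 0) (S : Finset ℕ) (k : ℕ) :
    ∀ m, m + k = S.card → 1 ≤ m → ∃ T ⊆ S, T.card = m ∧
      (S.card : ℝ) * (S.card - 1) * (∑ i ∈ T, ∑ j ∈ T, b i j) ≤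
        (m : ℝ) * (m - 1) * (∑ i ∈ S, ∑ j ∈ S, b i j) := by
  induction k with
  | zero => intro m hm _; exact ⟨S, subset_rfl, by omega, by simp at hm; rw [hm]⟩
  | succ k ih =>
    intro m hm h1
    obtain ⟨T, hTS, hT, hle⟩ := ih (m+1) (by omega) (by omega)
    set W := ∑ i ∈ T, ∑ j ∈ T, b i j with hW
    have hsum : ∑ i ∈ T, (∑ j ∈ T, b i j + ∑ j ∈ T, b j i) = 2 * W := by
      rw [Finset.sum_add_distrib, Finset.sum_comm (f := fun i j => b j i), hW]; ring
    have hne : T.Nonempty := Finset.card_pos.1 (by omega)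
    obtain ⟨i, hi, hge⟩ : ∃ i ∈ T, 2 * W / (m+1) ≤ ∑ j ∈ T, b i j + ∑ j ∈ T, b j i := by
      apply Finset.exists_le_of_sum_le hne
      rw [hsum, Finset.sum_const, hT, nsmul_eq_mul]
      push_cast
      apply le_of_eq
      field_simp
    refine ⟨T.erase i, (Finset.erase_subset _ _).trans hTS, by
      rw [Finset.card_erase_of_mem hi]; omega, ?_⟩
    have e : ∑ x ∈ T.erase i, ∑ y ∈ T.erase i, b x y
        = W - (∑ j ∈ T, b i j + ∑ j ∈ T, b j i) := by
      have h2 : ∀ x, ∑ y ∈ T.erase i, b x y = ∑ y ∈ T, b x y - b x i := by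
        intro x; rw [← Finset.add_sum_erase T _ hi]; ring
      simp only [h2]
      rw [Finset.sum_sub_distrib]
      have h3 := Finset.add_sum_erase T (fun x => ∑ y ∈ T, b x y) hi
      have h4 := Finset.add_sum_erase T (fun x => b x i) hi
      simp only [hb0] at h3 h4
      linarith
    rw [e]
    have hm1 : (1:ℝ) ≤ m := by exact_mod_cast h1
    have hc : (1:ℝ) ≤ S.card := by exact_mod_cast (by omega : 1 ≤ S.card)
    have hC : 0 ≤ (S.card : ℝ) * (S.card - 1) := mul_nonneg (by linarith) (by linarith)
    have a1 : W - (∑ j ∈ T, b i j + ∑ j ∈ T, b j i) ≤ (m - 1) / (m + 1) * W := by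
      have : (m - 1) / (m + 1) * W = W - 2 * W / (m+1) := by field_simp; ring
      linarith
    calc _ ≤ (S.card : ℝ) * (S.card - 1) * ((m - 1) / (m + 1) * W) := by gcongr
      _ = (m - 1) / (m + 1) * ((S.card : ℝ) * (S.card - 1) * W) := by ring
      _ ≤ (m - 1) / (m + 1) * (((m+1 : ℕ) : ℝ) * ((m+1 : ℕ) - 1)
            * (∑ i ∈ S, ∑ j ∈ S, b i j)) :=
          mul_le_mul_of_nonneg_left hle (div_nonneg (by linarith) (by linarith))
      _ = _ := by push_cast; field_simp; ring

lemma energy_eq {d : ℕ} (s : ℝ) (A : Set (EuclideanSpace ℝ (Fin d))) :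
    energy s (volume.restrict A) = ∫⁻ z in A ×ˢ A, edist z.1 z.2 ^ (-s) ∂(volume.prod volume) := by
  rw [energy, ← Measure.prod_restrict, lintegral_prod]
  exact (((measurable_fst.edist measurable_snd).pow_const (-s))).aemeasurable

lemma prod_union {d : ℕ} (Q : ℕ → Set (EuclideanSpace ℝ (Fin d))) (hQ : ∀ i, MeasurableSet (Q i))
    (hd : Pairwise (Function.onFun Disjoint Q)) (T : Finset ℕ)
    (f : EuclideanSpace ℝ (Fin d) × EuclideanSpace ℝ (Fin d) → ℝ≥0∞) :
    ∫⁻ z in (⋃ i ∈ T, Q i) ×ˢ (⋃ i ∈ T, Q i), f z ∂(volume.prod volume)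
      = ∑ i ∈ T, ∑ j ∈ T, ∫⁻ z in Q i ×ˢ Q j, f z ∂(volume.prod volume) := by
  have : (⋃ i ∈ T, Q i) ×ˢ (⋃ i ∈ T, Q i) = ⋃ q ∈ T ×ˢ T, Q q.1 ×ˢ Q q.2 := by
    ext ⟨x, y⟩; simp only [mem_prod, mem_iUnion, Finset.mem_product]
    constructor
    · rintro ⟨⟨i, hi, h⟩, ⟨j, hj, h'⟩⟩; exact ⟨(i, j), ⟨hi, hj⟩, h, h'⟩
    · rintro ⟨⟨i, j⟩, ⟨hi, hj⟩, h, h'⟩; exact ⟨⟨i, hi, h⟩, ⟨j, hj, h'⟩⟩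
  rw [this, lintegral_biUnion_finset, Finset.sum_product]
  · rintro ⟨i, j⟩ _ ⟨i', j'⟩ _ hne
    simp only [Function.onFun]
    rw [Set.disjoint_prod]
    by_cases h : i = i'
    · right; exact hd (by rintro rfl; exact hne (by rw [h]))
    · left; exact hd h
  · intro q _; exact (hQ _).prod (hQ _)

/-- For a Borel set `F` in the closed unit ball of `ℝ^d`, `0 < s < d` and `0 < p ≤ 1`,
there is a Borel subset `F₁ ⊆ F` with `L(F₁) = p L(F)` and `I_s(F₁) ≤ 2 p² I_s(F)`. -/
theorem stmt5 (d : ℕ) (s : ℝ) (hs : 0 < s) (hsd : s < d)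
    (F : Set (EuclideanSpace ℝ (Fin d))) (hF : MeasurableSet F)
    (hFsub : F ⊆ Metric.closedBall 0 1) (p : ℝ) (hp0 : 0 < p) (hp1 : p ≤ 1) :
    ∃ F₁ : Set (EuclideanSpace ℝ (Fin d)), MeasurableSet F₁ ∧ F₁ ⊆ F ∧
      volume F₁ = ENNReal.ofReal p * volume F ∧
      energy s (volume.restrict F₁) ≤ ENNReal.ofReal (2 * p ^ 2) * energy s (volume.restrict F) := by
  have hd : 0 < d := by
    have : (0:ℝ) < d := hs.trans hsd
    exact_mod_cast this
  have hfin : volume F ≠ ∞ :=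
    ((measure_mono hFsub).trans_lt measure_closedBall_lt_top).ne
  have hpV : ENNReal.ofReal p * volume F ≤ volume F :=
    mul_le_of_le_one_left bot_le (by simpa using hp1)
  simp only [energy_eq]
  set k : EuclideanSpace ℝ (Fin d) × EuclideanSpace ℝ (Fin d) → ℝ≥0∞ :=
    fun z => edist z.1 z.2 ^ (-s) with hk
  have hmono : ∀ {A B : Set (EuclideanSpace ℝ (Fin d))}, A ⊆ B →
      ∫⁻ z in A ×ˢ A, k z ∂(volume.prod volume) ≤ ∫⁻ z in B ×ˢ B, k z ∂(volume.prod volume) :=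
    fun h => lintegral_mono_set (prod_mono h h)
  set I := ∫⁻ z in F ×ˢ F, k z ∂(volume.prod volume) with hI
  have hc : ENNReal.ofReal (2 * p ^ 2) ≠ 0 := by
    simp only [ne_eq, ENNReal.ofReal_eq_zero, not_le]; positivity
  by_cases hItop : I = ∞
  · obtain ⟨B, hB, hBF, hBv⟩ := exists_sub_vol hd F hF hFsub _ hpV
    exact ⟨B, hB, hBF, hBv, by rw [hItop, ENNReal.mul_top hc]; exact le_top⟩
  by_cases hI0 : I = 0
  · obtain ⟨B, hB, hBF, hBv⟩ := exists_sub_vol hd F hF hFsub _ hpV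
    exact ⟨B, hB, hBF, hBv, ((hmono hBF).trans (le_of_eq hI0)).trans bot_le⟩
  have hε : ENNReal.ofReal (p ^ 2 / 2) * I ≠ 0 := by
    apply mul_ne_zero _ hI0
    simp only [ne_eq, ENNReal.ofReal_eq_zero, not_le]; positivity
  obtain ⟨δ, hδ, hac⟩ := exists_pos_setLIntegral_lt_of_measure_lt (hI ▸ hItop) hε
  -- choice of N
  obtain ⟨N, hN1, hN2, hN3⟩ : ∃ N : ℕ, 2 ≤ N ∧ 5 / p ≤ N ∧ volume F * volume F / N < δ := by
    have t : Tendsto (fun N : ℕ => volume F * volume F / N) atTop (nhds 0) :=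
      ENNReal.Tendsto.const_div ENNReal.tendsto_nat_nhds_top (by simp [hfin, ENNReal.mul_eq_top])
        |>.trans (by simp)
    obtain ⟨N, h1, h2, h3⟩ := ((eventually_ge_atTop 2).and
      ((tendsto_natCast_atTop_atTop.eventually_ge_atTop (5/p)).and (t.eventually_lt_const hδ))).exists
    exact ⟨N, h1, h2, h3⟩
  have hNpos : (0:ℝ) < N := by positivity
  have hN0 : (N : ℝ≥0∞) ≠ 0 := by simp; omega
  have hNt : (N : ℝ≥0∞) ≠ ∞ := by simp
  obtain ⟨Q, hQm, hQF, hQv, hQd⟩ := exists_part hd (volume F / N)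
    (ENNReal.div_ne_top hfin hN0) N F hF hFsub (ENNReal.mul_div_le)
  set a : ℕ → ℕ → ℝ≥0∞ := fun i j => ∫⁻ z in Q i ×ˢ Q j, k z ∂(volume.prod volume) with ha
  have hat : ∀ i j, a i j ≠ ∞ := fun i j =>
    ((lintegral_mono_set (prod_mono (hQF i) (hQF j))).trans_lt (lt_top_iff_ne_top.2 hItop)).ne
  -- the diagonal
  have hdiag : ∑ i ∈ Finset.range N, a i i ≤ ENNReal.ofReal (p ^ 2 / 2) * I := by
    have hdd : (↑(Finset.range N) : Set ℕ).PairwiseDisjoint (fun i => Q i ×ˢ Q i) := by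
      intro i _ j _ hij
      simp only [Function.onFun]
      rw [Set.disjoint_prod]
      exact Or.inl (hQd hij)
    have hsub : (⋃ i ∈ Finset.range N, Q i ×ˢ Q i) ⊆ F ×ˢ F :=
      iUnion₂_subset fun i _ => prod_mono (hQF i) (hQF i)
    have h1 := hac (⋃ i ∈ Finset.range N, Q i ×ˢ Q i) (by
      refine (Measure.restrict_apply_le _ _).trans_lt (lt_of_le_of_lt ?_ hN3)
      rw [measure_biUnion_finset hdd (fun i _ => (hQm i).prod (hQm i))]
      rw [Finset.sum_congr rfl (g := fun _ => volume F / N * (volume F / N)) (fun i hi => by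
        rw [Measure.prod_prod, hQv i (Finset.mem_range.1 hi)])]
      rw [Finset.sum_const, Finset.card_range, nsmul_eq_mul, ← mul_assoc,
        ENNReal.mul_div_cancel hN0 hNt, mul_div_assoc])
    rw [Measure.restrict_restrict_of_subset hsub,
      lintegral_biUnion_finset hdd (fun i _ => (hQm i).prod (hQm i))] at h1
    exact h1.le
  -- total
  have htot : ∑ i ∈ Finset.range N, ∑ j ∈ Finset.range N, a i j ≤ I := by
    rw [ha, ← prod_union Q hQm hQd]
    exact hmono (iUnion₂_subset fun i _ => hQF i)
  set b : ℕ → ℕ → ℝ := fun i j => if i = j then 0 else (a i j).toReal with hb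
  set m := ⌈p * N⌉₊ with hm
  have hm1 : 1 ≤ m := Nat.one_le_iff_ne_zero.2 (Nat.ceil_pos.2 (by positivity)).ne'
  have hmN : m ≤ N := Nat.ceil_le.2 (mul_le_of_le_one_left hNpos.le hp1)
  have hmlt : (m : ℝ) < p * N + 1 := Nat.ceil_lt_add_one (by positivity)
  have hmge : p * N ≤ m := Nat.le_ceil _
  obtain ⟨T, hTS, hTc, hTle⟩ := greedy b (by simp [hb]) (Finset.range N) (N - m) m
    (by simp; omega) hm1
  rw [Finset.card_range] at hTle
  have hbI : ∑ i ∈ Finset.range N, ∑ j ∈ Finset.range N, b i j ≤ I.toReal := by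
    refine le_trans ?_ (ENNReal.toReal_mono hItop htot)
    rw [ENNReal.toReal_sum (fun i _ => ENNReal.sum_ne_top.2 fun j _ => hat i j)]
    refine Finset.sum_le_sum fun i _ => ?_
    rw [ENNReal.toReal_sum (fun j _ => hat i j)]
    refine Finset.sum_le_sum fun j _ => ?_
    simp only [hb]; split_ifs <;> simp
  have hTb : ∑ i ∈ T, ∑ j ∈ T, b i j ≤ 3 / 2 * p ^ 2 * I.toReal := by
    have hN2' : (2:ℝ) ≤ N := by exact_mod_cast hN1
    have hm1' : (1:ℝ) ≤ m := by exact_mod_cast hm1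
    have hmN' : (m:ℝ) ≤ N := by exact_mod_cast hmN
    have h5 : 5 ≤ p * N := by rw [div_le_iff₀ hp0] at hN2; linarith
    have hq : (m:ℝ) * (m - 1) ≤ 3 / 2 * p ^ 2 * (N * (N - 1)) := by
      have q1 : (m - 1) * (N:ℝ) ≤ m * (N - 1) := by nlinarith
      have q2 : (m:ℝ) ^ 2 ≤ 3 / 2 * p ^ 2 * N ^ 2 := by
        have : (m:ℝ) ≤ 6 / 5 * (p * N) := by linarith
        have := pow_le_pow_left₀ (by linarith) this 2
        nlinarith [sq_nonneg (p * N)]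
      have q3 : (m:ℝ) * ((m - 1) * N) ≤ m * (m * (N - 1)) := by gcongr
      have q4 : (m:ℝ)^2 * (N - 1) ≤ 3 / 2 * p ^ 2 * N ^ 2 * (N - 1) :=
        mul_le_mul_of_nonneg_right q2 (by linarith)
      refine le_of_mul_le_mul_right ?_ hNpos
      nlinarith
    have hpos : (0:ℝ) < N * (N - 1) := by nlinarith
    refine le_of_mul_le_mul_left ?_ hpos
    have hmm : 0 ≤ (m:ℝ) * (m - 1) := mul_nonneg (by linarith) (by linarith)
    calc _ ≤ _ := hTle
      _ ≤ (m:ℝ) * (m - 1) * I.toReal := mul_le_mul_of_nonneg_left hbI hmm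
      _ ≤ 3 / 2 * p ^ 2 * (N * (N - 1)) * I.toReal :=
        mul_le_mul_of_nonneg_right hq ENNReal.toReal_nonneg
      _ = _ := by ring
  set G := ⋃ i ∈ T, Q i with hG
  have hGm : MeasurableSet G := T.measurableSet_biUnion fun i _ => hQm i
  have hGF : G ⊆ F := iUnion₂_subset fun i _ => hQF i
  have hGE : ∫⁻ z in G ×ˢ G, k z ∂(volume.prod volume) ≤ ENNReal.ofReal (2 * p ^ 2) * I := by
    rw [hG, prod_union Q hQm hQd]
    have e1 : ∀ i ∈ T, ∀ j ∈ T, a i j = ENNReal.ofReal (b i j) + if i = j then a i i else 0 := by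
      intro i _ j _
      simp only [hb]
      split_ifs with h
      · subst h; simp
      · rw [ENNReal.ofReal_toReal (hat i j), add_zero]
    have hb0 : ∀ i j, 0 ≤ b i j := by
      intro i j; simp only [hb]; split_ifs <;> simp
    calc ∑ i ∈ T, ∑ j ∈ T, a i j 
        = ∑ i ∈ T, ∑ j ∈ T, (ENNReal.ofReal (b i j) + if i = j then a i i else 0) :=
          Finset.sum_congr rfl fun i hi => Finset.sum_congr rfl fun j hj => e1 i hi j hj
      _ = ENNReal.ofReal (∑ i ∈ T, ∑ j ∈ T, b i j) + ∑ i ∈ T, a i i := by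
          rw [ENNReal.ofReal_sum_of_nonneg (fun i _ => Finset.sum_nonneg fun j _ => hb0 i j),
            ← Finset.sum_add_distrib]
          refine Finset.sum_congr rfl fun i hi => ?_
          rw [Finset.sum_add_distrib, ENNReal.ofReal_sum_of_nonneg (fun j _ => hb0 i j)]
          simp [hi]
      _ ≤ ENNReal.ofReal (3 / 2 * p ^ 2 * I.toReal) + ENNReal.ofReal (p ^ 2 / 2) * I :=
          add_le_add (ENNReal.ofReal_le_ofReal hTb)
            ((Finset.sum_le_sum_of_subset hTS).trans hdiag)
      _ = ENNReal.ofReal (2 * p ^ 2) * I := by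
          rw [ENNReal.ofReal_mul (by positivity), ENNReal.ofReal_toReal hItop, ← add_mul,
            ← ENNReal.ofReal_add (by positivity) (by positivity)]
          congr 2; ring
  have hGv : ENNReal.ofReal p * volume F ≤ volume G := by
    rw [hG, measure_biUnion_finset (fun i _ j _ hij => hQd hij) (fun i _ => hQm i),
      Finset.sum_congr rfl (fun i hi => hQv i (Finset.mem_range.1 (hTS hi))), Finset.sum_const,
      hTc, nsmul_eq_mul]
    calc ENNReal.ofReal p * volume F = ENNReal.ofReal p * (N * (volume F / N)) := by
          rw [ENNReal.mul_div_cancel hN0 hNt]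
      _ = ENNReal.ofReal (p * N) * (volume F / N) := by
          rw [ENNReal.ofReal_mul hp0.le, ENNReal.ofReal_natCast, mul_assoc]
      _ ≤ ENNReal.ofReal m * (volume F / N) := by gcongr
      _ = _ := by rw [ENNReal.ofReal_natCast]
  obtain ⟨B, hB, hBG, hBv⟩ := exists_sub_vol hd G hGm (hGF.trans hFsub) _ hGv
  exact ⟨B, hB, hBG.trans hGF, hBv, (hmono hBG).trans hGE⟩
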